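/- arXiv:1904.12202 — 2 statements merged into one kernel-verified Lean document; each statement's English description precedes it below -/
import Mathlib

section
/- For every element w of C_n there exist u, v ∈ C_n and an integer k ≥ 1 such that u w v = (x_n x_1 x_2 ⋯ x_{n−1})^k in C_n. (Equivalently, the ideal I_{n−2} = {w ∈ C_n : no u, v ∈ C_n and k ≥ 1 satisfy u w v = (x_n q_{n−2})^k} is empty.) -/
namespace HK

/-- The generator `x_k` of the free monoid on `ZMod n` (indices taken mod `n`,
so `x_n` is the letter `0`). -/
def fx (n k : ℕ) : FreeMonoid (ZMod n) := FreeMonoid.of (k : ZMod n)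

/-- The ascending word `x_a x_{a+1} ⋯ x_b` (empty if `b < a`). -/
def asc (n a b : ℕ) : FreeMonoid (ZMod n) :=
  FreeMonoid.ofList ((List.range' a (b + 1 - a)).map fun k => (k : ZMod n))

/-- The descending word `x_a x_{a-1} ⋯ x_b` (empty if `a < b`). -/
def desc (n a b : ℕ) : FreeMonoid (ZMod n) :=
  FreeMonoid.ofList (((List.range' b (a + 1 - b)).map fun k => (k : ZMod n)).reverse)

/-- `x_a ⋯ x_b`: ascending if `a ≤ b`, descending otherwise. -/
def seg (n a b : ℕ) : FreeMonoid (ZMod n) := if a ≤ b then asc n a b else desc n a b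

/-- The word `q_i = x_1 ⋯ x_i x_{n-1} x_{n-2} ⋯ x_{i+1}`. -/
def qw (n i : ℕ) : FreeMonoid (ZMod n) := asc n 1 i * desc n (n - 1) (i + 1)

/-- `|u|_c`: the number of occurrences of the letter `c` in the word `u`. -/
def cnt (n : ℕ) (u : FreeMonoid (ZMod n)) (c : ZMod n) : ℕ :=
  (FreeMonoid.toList u).count c

/-- `w` is a factor of `v`. -/
def IsFactor {α : Type*} (w v : FreeMonoid α) : Prop := ∃ v₁ v₂, v = v₁ * w * v₂

/-- A word is reduced if it contains no factor of the forms (1)–(5). -/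
def Reduced (n : ℕ) (w : FreeMonoid (ZMod n)) : Prop :=
  (∀ i : ℕ, 1 ≤ i → i ≤ n → ¬ IsFactor (fx n i * fx n i) w) ∧
  (∀ i j : ℕ, 1 ≤ i → j ≤ n → 1 < j - i → j - i < n - 1 →
      ¬ IsFactor (fx n j * fx n i) w) ∧
  (∀ i j : ℕ, 1 ≤ i → i + 1 < j → j < n - 1 →
      ¬ IsFactor (fx n n * asc n 1 i * fx n j) w) ∧
  (∀ i : ℕ, ∀ u : FreeMonoid (ZMod n), 1 ≤ i → i ≤ n → u ≠ 1 →
      cnt n u (i : ZMod n) = 0 → cnt n u ((i : ZMod n) - 1) = 0 →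
      ¬ IsFactor (fx n i * u * fx n i) w) ∧
  (∀ i : ℕ, ∀ u : FreeMonoid (ZMod n), 1 ≤ i → i ≤ n → u ≠ 1 →
      cnt n u (i : ZMod n) = 0 → cnt n u ((i : ZMod n) + 1) = 0 →
      ¬ IsFactor (fx n i * u * fx n i) w)

/-- Membership in the set `A_i`. -/
def InA (n i : ℕ) (a : FreeMonoid (ZMod n)) : Prop :=
  ∃ (s : ℕ) (k : ℕ → ℕ),
    s ≤ i + 1 ∧
    (1 ≤ s → 1 ≤ k s ∧ k s ≤ s) ∧
    (∀ t, s + 1 ≤ t → t ≤ i + 1 → t < k t ∧ k t ≤ n - 1) ∧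
    (∀ t, s + 1 ≤ t → t + 1 ≤ i + 1 → k t < k (t + 1)) ∧
    ∃ p : FreeMonoid (ZMod n),
      p * a = (if s = 0 then 1 else seg n (k s) s) *
        ((List.range' (s + 1) (i + 1 - s)).map fun t => seg n (k t) t).prod

/-- Membership in the set `B_i`. -/
def InB (n i : ℕ) (b : FreeMonoid (ZMod n)) : Prop :=
  ∃ (r : ℕ) (I J : ℕ → ℕ),
    (∀ t, 1 ≤ t → t ≤ r → 1 ≤ I t ∧ I t < i + 1) ∧
    (∀ t, 1 ≤ t → t + 1 ≤ r → I (t + 1) < I t) ∧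
    i + 1 < J 1 ∧
    (∀ t, 1 ≤ t → t + 1 ≤ r + 1 → J t < J (t + 1)) ∧
    J (r + 1) ≤ n ∧
    ∃ p : FreeMonoid (ZMod n),
      b * p = ((List.range' 1 r).map fun t =>
          fx n n * asc n 1 (I t) * desc n (n - 1) (J t)).prod *
        (fx n n * desc n (n - 1) (J (r + 1)))

/-- The defining relations of the Hecke–Kiselman monoid of the oriented cycle. -/
def cnRel (n : ℕ) : FreeMonoid (ZMod n) → FreeMonoid (ZMod n) → Prop := fun w v =>
  (∃ a : ZMod n, w = FreeMonoid.of a * FreeMonoid.of a ∧ v = FreeMonoid.of a) ∨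
  (∃ a b : ZMod n, b ≠ a + 1 ∧ a ≠ b + 1 ∧
    w = FreeMonoid.of a * FreeMonoid.of b ∧ v = FreeMonoid.of b * FreeMonoid.of a) ∨
  (∃ a : ZMod n,
    (w = FreeMonoid.of a * FreeMonoid.of (a + 1) * FreeMonoid.of a ∨
     w = FreeMonoid.of (a + 1) * FreeMonoid.of a * FreeMonoid.of (a + 1)) ∧
    v = FreeMonoid.of a * FreeMonoid.of (a + 1))

/-- The Hecke–Kiselman monoid `C_n` of the oriented cycle of length `n`. -/
abbrev Cn (n : ℕ) := (conGen (cnRel n)).Quotient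

/-- The canonical projection `F → C_n`. -/
def pr (n : ℕ) : FreeMonoid (ZMod n) →* Cn n := (conGen (cnRel n)).mk'

/-- The ideal `I_i` of `C_n`. -/
def Iset (n i : ℕ) : Set (Cn n) :=
  {w | ¬ ∃ (u v : Cn n) (k : ℕ), 1 ≤ k ∧ u * w * v = (pr n (fx n n * qw n i)) ^ k}


/-- Image of the generator in `Cn`. -/
def gg (n : ℕ) (a : ZMod n) : Cn n := pr n (FreeMonoid.of a)

/-- Ascending periodic words. -/
def SS (n : ℕ) : ℕ → Cn n
  | 0 => 1
  | m + 1 => SS n m * gg n (m : ZMod n)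

theorem pr_eq_of_rel {n : ℕ} {a b : FreeMonoid (ZMod n)} (h : cnRel n a b) :
    pr n a = pr n b :=
  (Con.eq _).2 (ConGen.Rel.of _ _ h)

theorem gg_idem (n : ℕ) (a : ZMod n) : gg n a * gg n a = gg n a := by
  have := pr_eq_of_rel (n := n) (Or.inl ⟨a, rfl, rfl⟩)
  rwa [map_mul] at this

theorem gg_comm (n : ℕ) (a b : ZMod n) (h1 : b ≠ a + 1) (h2 : a ≠ b + 1) :
    gg n a * gg n b = gg n b * gg n a := by
  have := pr_eq_of_rel (n := n) (Or.inr (Or.inl ⟨a, b, h1, h2, rfl, rfl⟩))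
  rwa [map_mul, map_mul] at this

theorem gg_braid (n : ℕ) (a : ZMod n) :
    gg n a * gg n (a + 1) * gg n a = gg n a * gg n (a + 1) := by
  have := pr_eq_of_rel (n := n) (Or.inr (Or.inr ⟨a, Or.inl rfl, rfl⟩))
  rwa [map_mul, map_mul] at this

theorem not_cast_zero {n e : ℕ} (h0 : 0 < e) (h : e < n) : (e : ZMod n) ≠ 0 := by
  rw [Ne, ZMod.natCast_eq_zero_iff]
  intro hd
  exact absurd (Nat.le_of_dvd h0 hd) (by omega)

theorem SS_absorb (n t d : ℕ) (hd : d + 2 ≤ n) :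
    SS n (t + 1 + d) * gg n (t : ZMod n) = SS n (t + 1 + d) := by
  induction d with
  | zero => simp only [SS, Nat.add_zero, mul_assoc, gg_idem]
  | succ d ih =>
    have ih := ih (by omega)
    rcases Nat.eq_zero_or_pos d with rfl | hpos
    · simp only [SS, Nat.add_zero, Nat.zero_add, Nat.cast_add, Nat.cast_one]
      rw [mul_assoc, mul_assoc, ← mul_assoc (gg n (t : ZMod n)), gg_braid, mul_assoc]
    · have e : SS n (t + 1 + (d + 1)) = SS n (t + 1 + d) * gg n ((t + 1 + d : ℕ) : ZMod n) := rfl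
      rw [e, mul_assoc, gg_comm, ← mul_assoc, ih]
      · intro h
        apply not_cast_zero (n := n) (e := d + 2) (by omega) (by omega)
        push_cast at h ⊢
        linear_combination -h
      · intro h
        apply not_cast_zero (n := n) (e := d) (by omega) (by omega)
        push_cast at h ⊢
        linear_combination h

theorem exists_rep (n : ℕ) (hn : 3 ≤ n) (m : ℕ) (hm : n ≤ m) (a : ZMod n) :
    ∃ t : ℕ, (t : ZMod n) = a ∧ t ≤ m ∧ m < t + n := by
  have : NeZero n := ⟨by omega⟩
  have hlt := ZMod.val_lt ((m : ZMod n) - a)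
  refine ⟨m - ((m : ZMod n) - a).val, ?_, by omega, by omega⟩
  rw [Nat.cast_sub (by omega), ZMod.natCast_zmod_val]
  ring

theorem SS_step (n : ℕ) (hn : 3 ≤ n) (m : ℕ) (hm : n ≤ m) (a : ZMod n) :
    ∃ m', n ≤ m' ∧ SS n m * gg n a = SS n m' := by
  obtain ⟨t, rfl, h1, h2⟩ := exists_rep n hn m hm a
  rcases h1.eq_or_lt with rfl | h
  · exact ⟨t + 1, by omega, rfl⟩
  · refine ⟨m, hm, ?_⟩
    obtain ⟨d, rfl⟩ := Nat.exists_eq_add_of_le (show t + 1 ≤ m from h)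
    exact SS_absorb n t d (by omega)

theorem SS_word (n : ℕ) (hn : 3 ≤ n) (w : FreeMonoid (ZMod n)) :
    ∀ m, n ≤ m → ∃ m', n ≤ m' ∧ SS n m * pr n w = SS n m' := by
  induction w using FreeMonoid.inductionOn' with
  | one => intro m hm; exact ⟨m, hm, by simp⟩
  | of_mul a w ih =>
    intro m hm
    obtain ⟨m₁, h1, e1⟩ := SS_step n hn m hm a
    obtain ⟨m₂, h2, e2⟩ := ih m₁ h1
    refine ⟨m₂, h2, ?_⟩
    rw [map_mul, ← mul_assoc, ← e2, ← e1]
    rfl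

theorem SS_add (n m r : ℕ) : ∃ v, SS n (m + r) = SS n m * v := by
  induction r with
  | zero => exact ⟨1, by simp⟩
  | succ r ih =>
    obtain ⟨v, hv⟩ := ih
    refine ⟨v * gg n ((m + r : ℕ) : ZMod n), ?_⟩
    rw [← mul_assoc, ← hv]
    rfl

theorem SS_period (n k r : ℕ) : SS n (n * k + r) = SS n (n * k) * SS n r := by
  induction r with
  | zero => simp [SS]
  | succ r ih =>
    rw [← Nat.add_assoc]
    simp only [SS]
    rw [ih, mul_assoc]
    simp

theorem SS_pow (n k : ℕ) : SS n (n * k) = SS n n ^ k := by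
  induction k with
  | zero => simp [SS]
  | succ k ih => rw [Nat.mul_succ, SS_period, ih, pow_succ]

theorem pr_range (n r : ℕ) :
    pr n (FreeMonoid.ofList ((List.range r).map fun k : ℕ => (k : ZMod n))) = SS n r := by
  induction r with
  | zero => exact map_one _
  | succ r ih =>
    rw [List.range_succ, List.map_append, FreeMonoid.ofList_append, map_mul, ih]
    rfl

theorem pr_cycle (n : ℕ) (hn : 3 ≤ n) : pr n (fx n n * asc n 1 (n - 1)) = SS n n := by
  obtain ⟨m, rfl⟩ : ∃ m, n = m + 1 := ⟨n - 1, by omega⟩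
  rw [← pr_range, List.range_eq_range', List.range'_succ, List.map_cons,
    FreeMonoid.ofList_cons]
  simp [fx, asc, ← List.map_eq_flatMap]
  rfl

/-- Corollary 3.2 (wn5): `I_{n-2} = ∅`. -/
theorem stmt5 (n : ℕ) (hn : 3 ≤ n) (w : Cn n) :
    ∃ (u v : Cn n) (k : ℕ), 1 ≤ k ∧
      u * w * v = (pr n (fx n n * asc n 1 (n - 1))) ^ k := by
  obtain ⟨w, rfl⟩ : ∃ w', pr n w' = w := Con.mk'_surjective w
  obtain ⟨m, hm, e⟩ := SS_word n hn w n le_rfl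
  obtain ⟨v, hv⟩ := SS_add n m (n * m - m)
  refine ⟨SS n n, v, m, by omega, ?_⟩
  rw [e, ← hv, pr_cycle n hn, ← SS_pow]
  congr 1
  have : m ≤ n * m := Nat.le_mul_of_pos_left m (by omega)
  omega

end HK
end

section
/- Let n ≥ 3, 0 ≤ i ≤ n−2 and w ∈ C_n. Then either (x_n q_i) w (x_n q_i) = (x_n q_i)^k in C_n for some k ≥ 2, or (x_n q_i) w (x_n q_i) ∈ I_i. -/
namespace HK

/-- Elementary move on the integer line. -/
def st (n : ℕ) (a : ZMod n) (z : ℤ) : ℤ := if (z : ZMod n) = a then z + 1 else z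

/-- Right action of words on the integers. -/
def A0 (n : ℕ) : FreeMonoid (ZMod n) →* (Function.End ℤ)ᵐᵒᵖ :=
  FreeMonoid.lift (fun a => MulOpposite.op (st n a : Function.End ℤ))

theorem A0_of (n : ℕ) (a : ZMod n) (z : ℤ) :
    (A0 n (FreeMonoid.of a)).unop z = st n a z := by
  simp only [A0, FreeMonoid.lift_eval_of]; rfl

theorem A0_mul (n : ℕ) (u v : FreeMonoid (ZMod n)) (z : ℤ) :
    (A0 n (u * v)).unop z = (A0 n v).unop ((A0 n u).unop z) := by
  rw [map_mul]; rfl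

theorem one_ne (n : ℕ) (hn : 3 ≤ n) : (1 : ZMod n) ≠ 0 := by
  intro h
  have : ((1 : ℕ) : ZMod n) = 0 := by exact_mod_cast h
  rw [ZMod.natCast_eq_zero_iff] at this
  have := Nat.le_of_dvd (by norm_num) this
  omega

theorem two_ne (n : ℕ) (hn : 3 ≤ n) : (1 + 1 : ZMod n) ≠ 0 := by
  intro h
  have : ((2 : ℕ) : ZMod n) = 0 := by push_cast; rw [← h]; norm_num
  rw [ZMod.natCast_eq_zero_iff] at this
  have := Nat.le_of_dvd (by norm_num) this
  omega

theorem A0_rel (n : ℕ) (hn : 3 ≤ n) : conGen (cnRel n) ≤ Con.ker (A0 n) := by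
  have h1 := one_ne n hn
  have h2 := two_ne n hn
  have h3 : ∀ a : ZMod n, a + 1 ≠ a := fun a h => h1 (by simpa using h)
  have h4 : ∀ a : ZMod n, a + 1 + 1 ≠ a := fun a h => h2 (by
    rw [add_assoc] at h; simpa using h)
  refine Con.conGen_le.2 ?_
  intro w v h
  change A0 n w = A0 n v
  apply MulOpposite.unop_injective
  funext z
  rcases h with ⟨a, rfl, rfl⟩ | ⟨a, b, hab, hba, rfl, rfl⟩ | ⟨a, rfl | rfl, rfl⟩
  · simp only [A0_mul, A0_of, st]
    by_cases hz : (z : ZMod n) = a <;> simp [hz, h3]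
  · simp only [A0_mul, A0_of, st]
    by_cases hz : (z : ZMod n) = a <;> by_cases hz' : (z : ZMod n) = b
    · have : a = b := hz.symm.trans hz'
      subst this; rfl
    · have hb : a + 1 ≠ b := fun h => hab h.symm
      have : a ≠ b := fun h => hz' (hz.trans h)
      simp [hz, hb, this]
    · have hb : b + 1 ≠ a := fun h => hba h.symm
      have : b ≠ a := fun h => hz (hz'.trans h)
      simp [hz', hb, this]
    · simp [hz, hz']
  · simp only [A0_mul, A0_of, st]
    by_cases hz : (z : ZMod n) = a <;> by_cases hz' : (z : ZMod n) = a + 1 <;>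
      simp [hz, hz', h3, h4]
  · simp only [A0_mul, A0_of, st]
    by_cases hz : (z : ZMod n) = a <;> by_cases hz' : (z : ZMod n) = a + 1
    · exact absurd (hz'.symm.trans hz) (h3 a)
    · simp [hz, (h3 _).symm]
    · simp [hz', h3, h4]
    · simp [hz, hz']

/-- Right action of the monoid on the integers. -/
def AA (n : ℕ) (hn : 3 ≤ n) : Cn n →* (Function.End ℤ)ᵐᵒᵖ :=
  (conGen (cnRel n)).lift (A0 n) (A0_rel n hn)

/-- Right action as a plain function. -/
def ac {n : ℕ} (hn : 3 ≤ n) (c : Cn n) (z : ℤ) : ℤ := (AA n hn c).unop z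

/-- Generators of the quotient. -/
def X {n : ℕ} (a : ZMod n) : Cn n := pr n (FreeMonoid.of a)

section
variable {n : ℕ} (hn : 3 ≤ n)

theorem ac_pr (w : FreeMonoid (ZMod n)) (z : ℤ) : ac hn (pr n w) z = (A0 n w).unop z := rfl

theorem ac_mul (c d : Cn n) (z : ℤ) : ac hn (c * d) z = ac hn d (ac hn c z) := by
  unfold ac; rw [map_mul]; rfl

theorem ac_one (z : ℤ) : ac hn 1 z = z := by
  unfold ac; rw [map_one]; rfl

theorem ac_X (a : ZMod n) (z : ℤ) : ac hn (X a) z = st n a z := by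
  unfold X; rw [ac_pr, A0_of]

theorem ac_pow (c : Cn n) (k : ℕ) (z : ℤ) : ac hn (c ^ k) z = (ac hn c)^[k] z := by
  induction k generalizing z with
  | zero => simp [ac_one]
  | succ k ih => rw [pow_succ', ac_mul, ih]; rfl

/-- Product of the generators of a list. -/
def W (l : List (ZMod n)) : Cn n := (l.map X).prod

theorem W_nil : W ([] : List (ZMod n)) = 1 := rfl
theorem W_cons (a : ZMod n) (l : List (ZMod n)) : W (a :: l) = X a * W l := by simp [W]

theorem pr_W (w : FreeMonoid (ZMod n)) : pr n w = W (FreeMonoid.toList w) := by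
  induction w using FreeMonoid.inductionOn' with
  | one => simp [W]
  | of_mul a w ih => rw [map_mul, ih, FreeMonoid.toList_of_mul, W_cons]; rfl

theorem exists_W (c : Cn n) : ∃ l, c = W l := by
  obtain ⟨w, rfl⟩ := Con.mk'_surjective (c := conGen (cnRel n)) c
  exact ⟨_, pr_W w⟩

theorem Cn_ind {P : Cn n → Prop} (h1 : P 1) (h2 : ∀ c a, P c → P (c * X a)) (c : Cn n) : P c := by
  obtain ⟨l, rfl⟩ := exists_W c
  induction l using List.reverseRecOn with
  | nil => exact h1
  | append_singleton l a ih =>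
    have : W (l ++ [a]) = W l * X a := by simp [W]
    rw [this]; exact h2 _ _ ih

theorem X_idem (a : ZMod n) : X a * X a = X a := by
  unfold X; rw [← map_mul]
  exact (Con.eq _).2 (ConGen.Rel.of _ _ (Or.inl ⟨a, rfl, rfl⟩))

theorem X_comm (a b : ZMod n) (h : b ≠ a + 1) (h' : a ≠ b + 1) : X a * X b = X b * X a := by
  unfold X; rw [← map_mul, ← map_mul]
  exact (Con.eq _).2 (ConGen.Rel.of _ _ (Or.inr (Or.inl ⟨a, b, h, h', rfl, rfl⟩)))

theorem X_br1 (a : ZMod n) : X a * X (a + 1) * X a = X a * X (a + 1) := by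
  unfold X; rw [← map_mul, ← map_mul]
  exact (Con.eq _).2 (ConGen.Rel.of _ _ (Or.inr (Or.inr ⟨a, Or.inl rfl, rfl⟩)))

theorem ac_ge (c : Cn n) : ∀ z, z ≤ ac hn c z := by
  induction c using Cn_ind with
  | h1 => intro z; rw [ac_one]
  | h2 c a ih =>
    intro z; rw [ac_mul, ac_X]; have := ih z
    unfold st; split_ifs <;> omega

theorem ac_mono (c : Cn n) : Monotone (ac hn c) := by
  induction c using Cn_ind with
  | h1 => intro y z h; rw [ac_one, ac_one]; exact h
  | h2 c a ih =>
    intro y z h; rw [ac_mul, ac_X, ac_mul, ac_X]; have := ih h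
    unfold st
    rcases this.eq_or_lt with h | h
    · rw [h]
    · split_ifs <;> omega

theorem ac_per (c : Cn n) : ∀ (z q : ℤ), ac hn c (z + n * q) = ac hn c z + n * q := by
  induction c using Cn_ind with
  | h1 => intro z q; rw [ac_one, ac_one]
  | h2 c a ih =>
    intro z q; rw [ac_mul, ac_X, ac_mul, ac_X, ih]
    unfold st
    have : ((ac hn c z + n * q : ℤ) : ZMod n) = (ac hn c z : ℤ) := by push_cast; simp
    rw [this]; split_ifs <;> ring

/-- `a` is occupied after `c`. -/
def Occ (c : Cn n) (a : ZMod n) : Prop := ∃ z : ℤ, ((ac hn c z : ℤ) : ZMod n) = a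

theorem occ_X_of_ne {c : Cn n} {a b : ZMod n} (h : Occ hn c a) (hab : a ≠ b) :
    Occ hn (c * X b) a := by
  obtain ⟨z, hz⟩ := h
  refine ⟨z, ?_⟩
  rw [ac_mul, ac_X, st, if_neg (by rw [hz]; exact hab), hz]

theorem occ_X_succ {c : Cn n} {a : ZMod n} (h : Occ hn c a) : Occ hn (c * X a) (a + 1) := by
  obtain ⟨z, hz⟩ := h
  refine ⟨z, ?_⟩
  rw [ac_mul, ac_X, st, if_pos hz]; push_cast; rw [hz]

theorem occ_of_X {c : Cn n} {a b : ZMod n} (h : Occ hn (c * X b) a) (hab : a ≠ b + 1) :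
    Occ hn c a := by
  obtain ⟨z, hz⟩ := h
  refine ⟨z, ?_⟩
  rw [ac_mul, ac_X, st] at hz
  split_ifs at hz with h
  · push_cast at hz; rw [h] at hz; exact absurd hz.symm hab
  · exact hz

/-- Absorption. -/
theorem absorb (c : Cn n) : ∀ a, ¬ Occ hn c a → c * X a = c := by
  have h1 := one_ne n hn
  have h2 := two_ne n hn
  have h3 : ∀ a : ZMod n, a + 1 ≠ a := fun a h => h1 (by simpa using h)
  have h4 : ∀ a : ZMod n, a + 1 + 1 ≠ a := fun a h => h2 (by
    rw [add_assoc] at h; simpa using h)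
  induction c using Cn_ind with
  | h1 =>
    intro a h
    exfalso; apply h
    obtain ⟨z, hz⟩ := ZMod.intCast_surjective a
    exact ⟨z, by rw [ac_one, hz]⟩
  | h2 c k ih =>
    intro j h
    by_cases hk : j = k
    · subst hk; rw [mul_assoc, X_idem]
    have hj : c * X j = c := ih j (fun hh => h (occ_X_of_ne hn hh hk))
    by_cases hk1 : j = k + 1
    · have hc : c * X k = c := ih k (fun hh => h (by rw [hk1]; exact occ_X_succ hn hh))
      rw [hc, hj]
    by_cases hk2 : k = j + 1
    · subst hk2
      nth_rewrite 1 [← hj]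
      rw [mul_assoc, mul_assoc, ← mul_assoc (X j), X_br1, ← mul_assoc, hj]
    · rw [mul_assoc, X_comm k j hk1 hk2, ← mul_assoc, hj]

theorem no_merge {b d : Cn n} {a : ZMod n}
    (hk : ∀ y z, ac hn (b * (X a * d)) y = ac hn (b * (X a * d)) z → ac hn b y = ac hn b z)
    (ha : Occ hn b a) : ¬ Occ hn b (a + 1) := by
  have h1 := one_ne n hn
  have h3 : ∀ a : ZMod n, a + 1 ≠ a := fun a h => h1 (by simpa using h)
  rintro ⟨z, hz⟩
  obtain ⟨y, hy⟩ := ha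
  have : ((ac hn b z - (ac hn b y + 1) : ℤ) : ZMod n) = 0 := by push_cast; rw [hz, hy]; simp
  rw [ZMod.intCast_zmod_eq_zero_iff_dvd] at this
  obtain ⟨q, hq⟩ := this
  have e1 := hk (y + n * q) z (by
    rw [← mul_assoc, ac_mul, ac_mul _ (b * X a), ac_mul, ac_mul _ b, ac_X, ac_X, ac_per]
    congr 1
    have : ((ac hn b y + n * q : ℤ) : ZMod n) = a := by push_cast; simp [hy]
    unfold st
    rw [if_pos this, if_neg (by rw [hz]; exact h3 a)]; omega)
  rw [ac_per] at e1; omega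

theorem bubble (l : List (ZMod n)) : ∀ (b : Cn n) (a : ZMod n),
    (∀ y z, ac hn (b * W l) y = ac hn (b * W l) z → ac hn b y = ac hn b z) →
    Occ hn b a → ¬ Occ hn b (a + 1) →
    (∃ z, ((ac hn b z : ℤ) : ZMod n) = a ∧ ac hn (b * W l) z ≠ ac hn b z) →
    ∃ l', b * W l = b * X a * W l' := by
  have h1 := one_ne n hn
  have h3 : ∀ a : ZMod n, a + 1 ≠ a := fun a h => h1 (by simpa using h)
  induction l with
  | nil =>
    rintro b a _ _ _ ⟨z, _, h⟩
    rw [W_nil, mul_one] at h; exact absurd rfl h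
  | cons c l ih =>
    rintro b a hk ha ha1 ⟨z, hz, hm⟩
    rw [W_cons] at hk hm ⊢
    by_cases hc : Occ hn b c
    · by_cases hca : c = a
      · subst hca; exact ⟨l, by rw [mul_assoc]⟩
      have hc1 : c ≠ a + 1 := fun h => ha1 (h ▸ hc)
      have hc2 : a ≠ c + 1 := fun h => no_merge hn hk hc (h ▸ ha)
      have hker : ∀ y z, ac hn (b * X c * W l) y = ac hn (b * X c * W l) z →
          ac hn (b * X c) y = ac hn (b * X c) z := by
        intro y z h
        rw [mul_assoc] at h
        rw [ac_mul, hk y z h, ac_mul]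
      have hzz : ac hn (b * X c) z = ac hn b z := by
        rw [ac_mul, ac_X, st, if_neg (by rw [hz]; exact fun h => hca h.symm)]
      obtain ⟨l', hl'⟩ := ih (b * X c) a hker (occ_X_of_ne hn ha (fun h => hca h.symm))
        (fun h => ha1 (occ_of_X hn h (fun h' => hca (by simpa using h'.symm))))
        ⟨z, by rw [hzz, hz], by rw [hzz, mul_assoc]; exact hm⟩
      refine ⟨c :: l', ?_⟩
      rw [← mul_assoc, hl', W_cons, mul_assoc b, X_comm c a hc2 hc1, ← mul_assoc, ← mul_assoc]
    · have hb := absorb hn b c hc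
      rw [← mul_assoc, hb] at hk hm ⊢
      exact ih b a hk ha ha1 ⟨z, hz, hm⟩

theorem triv (l : List (ZMod n)) : ∀ (b : Cn n), (∀ z, ac hn (b * W l) z = ac hn b z) →
    b * W l = b := by
  induction l with
  | nil => intro b _; rw [W_nil, mul_one]
  | cons c l ih =>
    intro b h
    rw [W_cons, ← mul_assoc] at h ⊢
    have hb : b * X c = b := by
      apply absorb hn
      rintro ⟨z, hz⟩
      have := h z
      rw [ac_mul, ac_mul, ac_X, st, if_pos hz] at this
      have := ac_ge hn (W l) (ac hn b z + 1)
      omega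
    rw [hb] at h ⊢
    exact ih b h

theorem inj_aux (l : List (ZMod n)) : ∀ (b : Cn n) (l' : List (ZMod n)),
    (∀ y z, ac hn (b * W l) y = ac hn (b * W l) z → ac hn b y = ac hn b z) →
    (∀ z, ac hn (b * W l) z = ac hn (b * W l') z) → b * W l = b * W l' := by
  induction l with
  | nil =>
    intro b l' _ h
    rw [W_nil, mul_one] at h ⊢
    exact (triv hn l' b (fun z => (h z).symm)).symm
  | cons a l ih =>
    intro b l' hk h
    rw [W_cons] at hk h ⊢
    by_cases ha : Occ hn b a
    · have ha1 := no_merge hn hk ha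
      obtain ⟨z, hz⟩ := id ha
      have hm : ac hn (b * W l') z ≠ ac hn b z := by
        rw [← h z, ← mul_assoc, ac_mul, ac_mul, ac_X, st, if_pos hz]
        have := ac_ge hn (W l) (ac hn b z + 1)
        omega
      obtain ⟨l'', hl''⟩ := bubble hn l' b a
        (fun y z e => hk y z (by rw [h, h, e])) ha ha1 ⟨z, hz, hm⟩
      rw [hl''] at h ⊢
      rw [← mul_assoc] at hk h ⊢
      exact ih (b * X a) l'' (fun y z e => by rw [ac_mul, hk y z e, ac_mul]) h
    · have hb := absorb hn b a ha
      rw [← mul_assoc, hb] at hk h ⊢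
      exact ih b l' hk h

theorem inj_main (b c d : Cn n)
    (hk : ∀ y z, ac hn (b * c) y = ac hn (b * c) z → ac hn b y = ac hn b z)
    (h : ∀ z, ac hn (b * c) z = ac hn (b * d) z) : b * c = b * d := by
  obtain ⟨l, rfl⟩ := exists_W c
  obtain ⟨l', rfl⟩ := exists_W d
  exact inj_aux hn l b l' hk h

theorem st_val (q : ℤ) (t k : ℕ) (ht : t < n) (hkn : k < n) :
    st n (k : ZMod n) (n * q + t) = n * q + (if t = k then t + 1 else t : ℕ) := by
  unfold st
  have : (((n * q + t : ℤ) : ZMod n) = (k : ZMod n)) ↔ t = k := by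
    push_cast
    rw [ZMod.natCast_self, zero_mul, zero_add, ZMod.natCast_eq_natCast_iff']
    rw [Nat.mod_eq_of_lt ht, Nat.mod_eq_of_lt hkn]
  by_cases h : t = k
  · rw [if_pos (this.2 h), if_pos h]; push_cast; ring
  · rw [if_neg (fun hh => h (this.1 hh)), if_neg h]

theorem W_append (l l' : List (ZMod n)) : W (l ++ l') = W l * W l' := by simp [W]

theorem ac_asc (q : ℤ) (t a len : ℕ) (ht : t < n) (hl : a + len < n) :
    ac hn (W ((List.range' a len).map fun k : ℕ => (k : ZMod n))) (n * q + t) =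
      n * q + (if a ≤ t ∧ t < a + len then a + len else t : ℕ) := by
  induction len with
  | zero => rw [if_neg (by omega)]; simp [W, ac_one]
  | succ len ih =>
    rw [List.range'_1_concat, List.map_append, W_append, ac_mul, ih (by omega)]
    simp only [List.map_cons, List.map_nil, W_cons, W_nil, mul_one, ac_X]
    rw [st_val]
    · congr 2; split_ifs <;> omega
    · split_ifs <;> omega
    · omega

theorem ac_desc (q : ℤ) (b len : ℕ) : ∀ (t : ℕ) (_ : t < n) (_ : b + len ≤ n) (_ : 0 < b),
    ac hn (W ((List.range' b len).map fun k : ℕ => (k : ZMod n)).reverse) (n * q + t) =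
      n * q + (if b ≤ t ∧ t < b + len then t + 1 else t : ℕ) := by
  induction len generalizing b with
  | zero => intro t ht hl hb; rw [if_neg (by omega)]; simp [W, ac_one]
  | succ len ih =>
    intro t ht hl hb0
    rw [List.range'_succ, List.map_cons, List.reverse_cons, W_append, ac_mul,
      ih (b + 1) t ht (by omega) (by omega)]
    simp only [W_cons, W_nil, mul_one, ac_X]
    by_cases h : b + 1 ≤ t ∧ t < b + 1 + len
    · rw [if_pos h, if_pos (by omega)]
      by_cases h' : t + 1 < n
      · rw [st_val _ _ _ h' (by omega), if_neg (by omega)]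
      · have h2 : (n : ℤ) * q + (t + 1 : ℕ) = n * (q + 1) + (0 : ℕ) := by
          have : n = t + 1 := by omega
          rw [← this]; push_cast; ring
        rw [h2]
        rw [st_val _ _ _ (by omega) (by omega), if_neg (by omega)]
    · rw [if_neg h, st_val _ _ _ ht (by omega)]
      congr 2; split_ifs <;> omega


theorem asc_list (a b : ℕ) : FreeMonoid.toList (asc n a b) =
    (List.range' a (b + 1 - a)).map fun k : ℕ => (k : ZMod n) := by
  unfold asc
  rw [FreeMonoid.toList_ofList]
  simp only [List.bind_eq_flatMap, List.pure_def, List.map_id']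
  first | rw [List.map_eq_flatMap] | (congr 1; rw [List.map_eq_flatMap])

theorem desc_list (a b : ℕ) : FreeMonoid.toList (desc n a b) =
    ((List.range' b (a + 1 - b)).map fun k : ℕ => (k : ZMod n)).reverse := by
  unfold desc
  rw [FreeMonoid.toList_ofList]
  simp only [List.bind_eq_flatMap, List.pure_def, List.map_id']
  first | rw [List.map_eq_flatMap] | (congr 1; rw [List.map_eq_flatMap])

theorem ac_g (i : ℕ) (hi : i ≤ n - 2) (q : ℤ) (t : ℕ) (ht : t < n) :
    ac hn (pr n (fx n n * qw n i)) (n * q + t) = n * q + (max (i + 2) (t + 1) : ℕ) := by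
  have h0 : pr n (fx n n) = X ((0 : ℕ) : ZMod n) := by simp [fx, X]
  rw [map_mul, qw, map_mul, h0, pr_W (asc n 1 i), pr_W (desc n _ _), asc_list, desc_list,
    ac_mul, ac_mul, ac_X, st_val q t 0 ht (by omega), ac_asc, ac_desc]
  · congr 2; split_ifs <;> omega
  · split_ifs <;> omega
  · omega
  · omega
  · split_ifs <;> omega
  · omega

theorem exists_qt (hn : 3 ≤ n) (z : ℤ) : ∃ (q : ℤ) (t : ℕ), t < n ∧ z = n * q + t := by
  have hp : (0 : ℤ) < n := by omega
  refine ⟨z / n, (z % n).toNat, ?_, ?_⟩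
  · have := Int.emod_lt_of_pos z hp
    have := Int.emod_nonneg z hp.ne'
    omega
  · have := Int.emod_nonneg z hp.ne'
    rw [Int.toNat_of_nonneg this, Int.mul_ediv_add_emod]

theorem g_gt (i : ℕ) (hi : i ≤ n - 2) (z : ℤ) : z < ac hn (pr n (fx n n * qw n i)) z := by
  obtain ⟨q, t, ht, rfl⟩ := exists_qt hn z
  rw [ac_g hn i hi q t ht]
  have : t + 1 ≤ max (i + 2) (t + 1) := le_max_right _ _
  omega

theorem g_surj (i : ℕ) (hi : i ≤ n - 2) (z : ℤ) : ∃ y,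
    ac hn (pr n (fx n n * qw n i)) (ac hn (pr n (fx n n * qw n i)) y) =
      ac hn (pr n (fx n n * qw n i)) z := by
  obtain ⟨q, t, ht, rfl⟩ := exists_qt hn z
  rw [ac_g hn i hi q t ht]
  by_cases h : t ≤ i + 1
  · refine ⟨n * (q - 1) + (n - 1 : ℕ), ?_⟩
    rw [ac_g hn i hi (q - 1) (n - 1) (by omega)]
    have : (n : ℤ) * (q - 1) + (max (i + 2) (n - 1 + 1) : ℕ) = n * q + (0 : ℕ) := by
      have : max (i + 2) (n - 1 + 1) = n := by omega
      rw [this]; push_cast; ring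
    rw [this, ac_g hn i hi q 0 (by omega)]
    congr 2; omega
  · refine ⟨n * q + (t - 1 : ℕ), ?_⟩
    rw [ac_g hn i hi q (t - 1) (by omega)]
    have : max (i + 2) (t - 1 + 1) = t := by omega
    rw [this, ac_g hn i hi q t (by omega)]

theorem g_succ (i : ℕ) (hi : i ≤ n - 2) (y z : ℤ)
    (h : ac hn (pr n (fx n n * qw n i)) y < ac hn (pr n (fx n n * qw n i)) z) :
    ac hn (pr n (fx n n * qw n i)) (ac hn (pr n (fx n n * qw n i)) y) ≤
      ac hn (pr n (fx n n * qw n i)) z := by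
  obtain ⟨q, t, ht, rfl⟩ := exists_qt hn z
  obtain ⟨p, s, hs, rfl⟩ := exists_qt hn y
  rw [ac_g hn i hi q t ht, ac_g hn i hi p s hs] at *
  have a1 : i + 2 ≤ max (i + 2) (t + 1) := le_max_left _ _
  have a2 : max (i + 2) (t + 1) ≤ n := by omega
  have a3 : i + 2 ≤ max (i + 2) (s + 1) := le_max_left _ _
  have a4 : max (i + 2) (s + 1) ≤ n := by omega
  generalize max (i + 2) (t + 1) = b at *
  generalize max (i + 2) (s + 1) = a at *
  rcases a4.eq_or_lt with e | e
  · subst e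
    have e2 : (a : ℤ) * p + a = a * (p + 1) + (0 : ℕ) := by push_cast; ring
    rw [e2, ac_g hn i hi (p + 1) 0 (by omega)]
    rw [e2] at h
    have hpq : p + 1 ≤ q := by
      by_contra hc
      have : (a : ℤ) * q ≤ a * p := mul_le_mul_of_nonneg_left (by omega) (by omega)
      have e3 : (a : ℤ) * (p + 1) = a * p + a := by ring
      omega
    have : (a : ℤ) * (p + 1) ≤ a * q := mul_le_mul_of_nonneg_left hpq (by omega)
    have : max (i + 2) (0 + 1) = i + 2 := by omega
    omega
  · rw [ac_g hn i hi p a e]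
    have : max (i + 2) (a + 1) = a + 1 := by omega
    rw [this]; omega

/-- The induced map modulo `n`. -/
def bar (c : Cn n) (y : ZMod n) : ZMod n := ((ac hn c (y.val : ℤ) : ℤ) : ZMod n)

theorem bar_cast (c : Cn n) (z : ℤ) : bar hn c (z : ZMod n) = ((ac hn c z : ℤ) : ZMod n) := by
  unfold bar
  have : NeZero n := ⟨by omega⟩
  have h : (((z - ((z : ZMod n).val : ℤ)) : ℤ) : ZMod n) = 0 := by
    push_cast; rw [ZMod.natCast_zmod_val]; simp
  rw [ZMod.intCast_zmod_eq_zero_iff_dvd] at h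
  obtain ⟨q, hq⟩ := h
  have : z = ((z : ZMod n).val : ℤ) + n * q := by omega
  conv_rhs => rw [this]
  rw [ac_per]; push_cast; simp

/-- Main abstract argument. -/
theorem main_aux (g w : Cn n) (hgt : ∀ z, z < ac hn g z)
    (hsurj : ∀ z, ∃ y, ac hn g (ac hn g y) = ac hn g z)
    (hsucc : ∀ y z, ac hn g y < ac hn g z → ac hn g (ac hn g y) ≤ ac hn g z)
    (u v : Cn n) (m : ℕ) (hm : u * (g * w * g) * v = g ^ m) :
    ∃ k, 2 ≤ k ∧ g * w * g = g ^ k := by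
  have : NeZero n := ⟨by omega⟩
  set G := ac hn g with hG
  set h := ac hn (w * g) with hh
  set F := ac hn (w * g * v * g) with hF
  have hF' : ∀ z, F z = G (ac hn v (h z)) := by
    intro z; rw [hF, ac_mul, ac_mul]
  have hhw : ∀ z, h z = G (ac hn w z) := by intro z; rw [hh, ac_mul]
  have hGm : ∀ m z, ∃ y, G^[m + 1] y = G z := by
    intro m
    induction m with
    | zero => intro z; exact ⟨z, rfl⟩
    | succ m ih =>
      intro z
      obtain ⟨y, hy⟩ := hsurj z
      obtain ⟨x, hx⟩ := ih y
      exact ⟨x, by rw [Function.iterate_succ_apply', hx, hy]⟩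
  have hm' : u * g * (w * g * v * g) = g ^ (m + 1) := by
    rw [pow_succ, ← hm]; simp only [mul_assoc]
  have hFs : ∀ z, ∃ y, F (G y) = G z := by
    intro z
    obtain ⟨y, hy⟩ := hGm m z
    refine ⟨ac hn u y, ?_⟩
    rw [← hy, hG, ← ac_pow, ← hm', ac_mul hn (u * g), ac_mul hn u g]
  -- finite set of residues
  classical
  let T : Finset (ZMod n) := Finset.univ.filter (fun a => ∃ z : ℤ, ((G z : ℤ) : ZMod n) = a)
  have hT : ∀ a, a ∈ T ↔ ∃ z : ℤ, ((G z : ℤ) : ZMod n) = a := by intro a; simp [T]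
  have cong : ∀ y z : ℤ, (y : ZMod n) = z → ∃ q : ℤ, z = y + n * q := by
    intro y z e
    have : ((z - y : ℤ) : ZMod n) = 0 := by push_cast; rw [e]; simp
    rw [ZMod.intCast_zmod_eq_zero_iff_dvd] at this
    obtain ⟨q, hq⟩ := this
    exact ⟨q, by omega⟩
  have Finj : Set.InjOn (bar hn (w * g * v * g)) T := by
    apply Finset.injOn_of_surjOn_of_card_le (t := T)
    · intro a ha
      obtain ⟨z, rfl⟩ := (hT a).1 ha
      rw [bar_cast]
      exact (hT _).2 ⟨_, by rw [← hF, hF']⟩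
    · intro a ha
      obtain ⟨z, rfl⟩ := (hT a).1 ha
      obtain ⟨y, hy⟩ := hFs z
      exact ⟨((G y : ℤ) : ZMod n), (hT _).2 ⟨y, rfl⟩, by rw [bar_cast, ← hF, hy]⟩
    · exact le_rfl
  have hinj : ∀ y z, h (G y) = h (G z) → G y = G z := by
    intro y z e
    have e1 : F (G y) = F (G z) := by rw [hF', hF', e]
    have e2 : ((G y : ℤ) : ZMod n) = (G z : ℤ) :=
      Finj ((hT _).2 ⟨y, rfl⟩) ((hT _).2 ⟨z, rfl⟩) (by rw [bar_cast, bar_cast, ← hF, e1])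
    obtain ⟨q, hq⟩ := cong _ _ e2
    rw [hq, hh, ac_per] at e
    omega
  have hper : ∀ z q : ℤ, h (z + n * q) = h z + n * q := ac_per hn _
  have Gper : ∀ z q : ℤ, G (z + n * q) = G z + n * q := ac_per hn _
  have hbinj : Set.InjOn (bar hn (w * g)) T := by
    intro a ha b hb e
    obtain ⟨y, rfl⟩ := (hT a).1 ha
    obtain ⟨z, rfl⟩ := (hT b).1 hb
    rw [bar_cast, bar_cast, ← hh] at e
    obtain ⟨q, hq⟩ := cong _ _ e
    rw [← hper, ← Gper] at hq
    have := hinj _ _ hq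
    rw [this, Gper]; push_cast; simp
  have hbs : Set.SurjOn (bar hn (w * g)) T T := by
    apply Finset.surjOn_of_injOn_of_card_le (t := T) _ _ hbinj le_rfl
    intro a ha
    obtain ⟨z, rfl⟩ := (hT a).1 ha
    rw [bar_cast]
    exact (hT _).2 ⟨_, by rw [← hh, hhw]⟩
  have hs : ∀ z, ∃ y, h (G y) = G z := by
    intro z
    obtain ⟨a, ha, e⟩ := hbs ((hT _).2 ⟨z, rfl⟩)
    obtain ⟨y, rfl⟩ := (hT a).1 ha
    rw [bar_cast, ← hh] at e
    obtain ⟨q, hq⟩ := cong _ _ e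
    exact ⟨y + n * q, by rw [Gper, hper, hq]⟩
  have hmono : Monotone h := ac_mono hn _
  have hcomm : ∀ z, h (G (G z)) = G (h (G z)) := by
    intro z
    have l1 : h (G z) < h (G (G z)) := by
      refine lt_of_le_of_ne (hmono (hgt _).le) (fun e => ?_)
      have := hinj _ _ e
      have := hgt (G z)
      omega
    have l2 : G (h (G z)) ≤ h (G (G z)) := by
      rw [hhw (G z), hhw (G (G z))] at *
      exact hsucc _ _ l1
    refine le_antisymm ?_ l2
    by_contra hc
    push Not at hc
    obtain ⟨y, hy⟩ := hs (h (G z))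
    rw [← hy] at hc
    have m1 : G y < G (G z) := hmono.reflect_lt hc
    have m2 : G z < G y := by
      apply hmono.reflect_lt
      rw [hy]; exact hgt _
    have := hsucc _ _ m2
    omega
  have hcommk : ∀ t z, h (G^[t] (G z)) = G^[t] (h (G z)) := by
    intro t
    induction t with
    | zero => intro z; rfl
    | succ t ih =>
      intro z
      rw [Function.iterate_succ_apply, ih, hcomm, Function.iterate_succ_apply]
  have climb : ∀ (d : ℕ) (y z : ℤ), G z - G y ≤ d → G y ≤ G z → ∃ j, G z = G^[j] (G y) := by
    intro d
    induction d with
    | zero => intro y z h1 h2; exact ⟨0, by simp; omega⟩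
    | succ d ih =>
      intro y z h1 h2
      rcases h2.eq_or_lt with e | e
      · exact ⟨0, by simp [e]⟩
      · have := hgt (G y)
        obtain ⟨j, hj⟩ := ih (G y) z (by push_cast at h1; omega) (hsucc _ _ e)
        exact ⟨j + 1, by rw [hj, Function.iterate_succ_apply]⟩
  have climb' : ∀ y z, G y ≤ G z → ∃ j, G z = G^[j] (G y) := by
    intro y z e
    exact climb (G z - G y).toNat y z (by omega) e
  have hgth : ∀ z, z < h z := by
    intro z; rw [hhw]
    have := ac_ge hn w z
    have := hgt (ac hn w z)
    omega
  obtain ⟨j, hj⟩ : ∃ j, h (G 0) = G^[j] (G 0) := by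
    have := hgth (G 0)
    rw [hhw] at this ⊢
    exact climb' _ _ this.le
  have hj1 : 1 ≤ j := by
    rcases Nat.eq_zero_or_pos j with e | e
    · subst e
      have := hgth (G 0)
      rw [hj] at this
      simp at this
    · exact e
  have hall0 : ∀ z, G 0 ≤ G z → h (G z) = G^[j] (G z) := by
    intro z hz
    obtain ⟨t, ht⟩ := climb' _ _ hz
    rw [ht, hcommk, hj, ← Function.iterate_add_apply, ← Function.iterate_add_apply, add_comm]
  have Gjper : ∀ z q : ℤ, G^[j] (z + n * q) = G^[j] z + n * q := by
    intro z q
    rw [hG, ← ac_pow, ← ac_pow, ac_per]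
  have hall : ∀ z, h (G z) = G^[j] (G z) := by
    intro z
    have e := hall0 (z + n * (|z|)) (by
      apply ac_mono hn g
      have h1 : (1 : ℤ) * |z| ≤ n * |z| := mul_le_mul_of_nonneg_right (by omega) (abs_nonneg z)
      have := neg_abs_le z
      omega)
    rw [Gper, hper, Gjper] at e
    omega
  refine ⟨j + 1, by omega, ?_⟩
  rw [pow_succ', mul_assoc]
  apply inj_main hn
  · intro y z e
    rw [ac_mul hn g, ac_mul hn g] at e
    exact hinj y z e
  · intro z
    rw [ac_mul hn g (w * g), ac_mul hn g (g ^ j), ac_pow]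
    exact hall z

end

/-- Theorem 3.11 (tw3). -/
theorem stmt8 (n i : ℕ) (hn : 3 ≤ n) (hi : i ≤ n - 2) (w : Cn n) :
    (∃ k : ℕ, 2 ≤ k ∧
      pr n (fx n n * qw n i) * w * pr n (fx n n * qw n i) =
        (pr n (fx n n * qw n i)) ^ k) ∨
    pr n (fx n n * qw n i) * w * pr n (fx n n * qw n i) ∈ Iset n i := by
  by_cases h : pr n (fx n n * qw n i) * w * pr n (fx n n * qw n i) ∈ Iset n i
  · exact Or.inr h
  · left
    unfold Iset at h
    rw [Set.mem_ofPred_eq, not_not] at h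
    obtain ⟨u, v, m, _, hm⟩ := h
    exact main_aux hn _ w (g_gt hn i hi) (g_surj hn i hi) (g_succ hn i hi) u v m hm

end HK
end
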